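/- Fix x_i ∈ ℝ^d, a prior p ∈ (0,1) and a real weight a ∈ ℝ, and define G : ℝ^d → ℝ^d by G(y) = γ · ( P_p(x_i, y) − a ) · (x_i − y). Then G is differentiable, and its Fréchet derivative at any y ∈ ℝ^d is represented by the d×d matrix −γ·( P_p(x_i, y) − a )·I + γ² · P_p(x_i, y)·(1 − P_p(x_i, y)) · (x_i − y)(x_i − y)ᵀ, where I is the d×d identity matrix and (x_i − y)(x_i − y)ᵀ denotes the outer product. -/

import Mathlib

/-- The half-normal density with spread parameter `σ`. -/
noncomputable def halfNormal (σ r : ℝ) : ℝ :=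
  (Real.sqrt 2 / (σ * Real.sqrt Real.pi)) * Real.exp (-(r ^ 2) / (2 * σ ^ 2))

/-- The CNE link probability of two points `x y : ℝ^d` with prior `p`. -/
noncomputable def cneP (σ₁ σ₂ p : ℝ) {d : ℕ} (x y : EuclideanSpace ℝ (Fin d)) : ℝ :=
  p * halfNormal σ₁ ‖x - y‖ /
    (p * halfNormal σ₁ ‖x - y‖ + (1 - p) * halfNormal σ₂ ‖x - y‖)

theorem halfNormal_pos {σ : ℝ} (hσ : 0 < σ) (r : ℝ) : 0 < halfNormal σ r := by
  unfold halfNormal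
  positivity

theorem hasFDerivAt_halfNormal_norm_sub {E : Type*} [NormedAddCommGroup E]
    [InnerProductSpace ℝ E] {σ : ℝ} (hσ : σ ≠ 0) (x y : E) :
    HasFDerivAt (fun y => halfNormal σ ‖x - y‖)
      ((halfNormal σ ‖x - y‖ * (1 / σ ^ 2)) • innerSL ℝ (x - y)) y := by
  have hsq := ((hasFDerivAt_id (𝕜 := ℝ) y).const_sub x).norm_sq
  have h := ((hsq.neg.mul_const (2 * σ ^ 2)⁻¹).exp).const_mul
    (Real.sqrt 2 / (σ * Real.sqrt Real.pi))
  simp only [← div_eq_mul_inv] at h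
  refine h.congr_fderiv ?_
  ext v
  simp [halfNormal]
  field_simp
  ring

theorem cneP_denom_pos {σ₁ σ₂ p : ℝ} (hσ₁ : 0 < σ₁) (hσ₂ : 0 < σ₂) (hp0 : 0 < p) (hp1 : p < 1)
    (r : ℝ) : 0 < p * halfNormal σ₁ r + (1 - p) * halfNormal σ₂ r :=
  add_pos (mul_pos hp0 (halfNormal_pos hσ₁ r))
    (mul_pos (sub_pos.2 hp1) (halfNormal_pos hσ₂ r))

theorem hasFDerivAt_cneP {d : ℕ} {σ₁ σ₂ p : ℝ} (hσ₁ : 0 < σ₁) (hσ₂ : 0 < σ₂) (hp0 : 0 < p)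
    (hp1 : p < 1) (x y : EuclideanSpace ℝ (Fin d)) :
    HasFDerivAt (cneP σ₁ σ₂ p x)
      (((1 / σ₁ ^ 2 - 1 / σ₂ ^ 2) * (cneP σ₁ σ₂ p x y * (1 - cneP σ₁ σ₂ p x y))) •
        innerSL ℝ (x - y)) y := by
  have hne := (cneP_denom_pos hσ₁ hσ₂ hp0 hp1 ‖x - y‖).ne'
  have hf := (hasFDerivAt_halfNormal_norm_sub hσ₁.ne' x y).const_mul p
  have hg := (hasFDerivAt_halfNormal_norm_sub hσ₂.ne' x y).const_mul (1 - p)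
  refine (hf.mul ((hasDerivAt_inv hne).comp_hasFDerivAt y (hf.add hg))).congr_fderiv ?_
  ext v
  simp only [cneP, smul_apply, add_apply, smul_eq_mul, Function.comp_apply, Pi.add_apply]
  field_simp
  ring

/-- The map `G(y) = γ·(P_p(x_i, y) − a)·(x_i − y)` is differentiable, and its Fréchet
derivative at `y` is represented by the matrix
`−γ·(P_p(x_i,y) − a)·I + γ²·P_p(x_i,y)(1 − P_p(x_i,y))·(x_i−y)(x_i−y)ᵀ`. -/
theorem cne_cross_hessian (d : ℕ) (hd : 1 ≤ d)
    (σ₁ σ₂ : ℝ) (hσ₁ : 0 < σ₁) (hσ₁₂ : σ₁ < σ₂)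
    (γ : ℝ) (hγ : γ = 1 / σ₁ ^ 2 - 1 / σ₂ ^ 2)
    (xi : EuclideanSpace ℝ (Fin d)) (p : ℝ) (hp0 : 0 < p) (hp1 : p < 1) (a : ℝ)
    (G : EuclideanSpace ℝ (Fin d) → EuclideanSpace ℝ (Fin d))
    (hG : G = fun y => γ • ((cneP σ₁ σ₂ p xi y - a) • (xi - y))) :
    Differentiable ℝ G ∧
    ∀ y : EuclideanSpace ℝ (Fin d),
      fderiv ℝ G y = Matrix.toEuclideanCLM (𝕜 := ℝ)
        (-(γ • ((cneP σ₁ σ₂ p xi y - a) • (1 : Matrix (Fin d) (Fin d) ℝ)))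
          + γ ^ 2 • (cneP σ₁ σ₂ p xi y * (1 - cneP σ₁ σ₂ p xi y)) •
              Matrix.vecMulVec (fun i => (xi - y) i) (fun i => (xi - y) i)) := by
  have key : ∀ y, HasFDerivAt G (Matrix.toEuclideanCLM (𝕜 := ℝ)
      (-(γ • ((cneP σ₁ σ₂ p xi y - a) • (1 : Matrix (Fin d) (Fin d) ℝ)))
        + γ ^ 2 • (cneP σ₁ σ₂ p xi y * (1 - cneP σ₁ σ₂ p xi y)) •
            Matrix.vecMulVec (fun i => (xi - y) i) (fun i => (xi - y) i))) y := by
    intro y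
    have hP := hasFDerivAt_cneP hσ₁ (hσ₁.trans hσ₁₂) hp0 hp1 xi y
    rw [← hγ] at hP
    rw [hG]
    refine (((hP.sub_const a).smul ((hasFDerivAt_id y).const_sub xi)).const_smul γ).congr_fderiv ?_
    ext v i
    have hv : (fun i => xi i - y i) ⬝ᵥ v.ofLp = inner ℝ xi v - inner ℝ y v := by
      simp [PiLp.inner_apply, dotProduct, mul_comm (v.ofLp _), sub_mul, Finset.sum_sub_distrib]
    simp [Matrix.vecMulVec_mulVec, hv]
    ring
  exact ⟨fun y => (key y).differentiableAt, fun y => (key y).fderiv⟩
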